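/- arXiv:1807.07110 — 4 statements merged into one kernel-verified Lean document; each statement's English description precedes it below -/
import Mathlib

section
/- Let M be a countably infinite homogeneous structure in a finite binary relational language with a distinguished linear order ≤ among its relations, such that M is order-like and its automorphism group acts transitively on M. Let E be the coarsest proper ∅-definable ≤-convex equivalence relation on M (E is ∅-definable, ≤-convex, not the trivial relation, and every ∅-definable ≤-convex equivalence relation other than the trivial relation refines E). Let F be a ∅-definable equivalence relation that does not refine E. Then every F-class C intersects a dense set of E-classes: for all u, v ∈ M with u < v and (u,v) ∉ E, there exists z ∈ C with u < z < v, (z,u) ∉ E, and (z,v) ∉ E. -/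
/-- A structure on `M` with `m` binary relations, among which a distinguished linear order,
given by the index `ord`. -/
structure BinStruct (m : ℕ) (M : Type*) where
  rel : Fin m → M → M → Prop
  ord : Fin m
  total : ∀ x y, rel ord x y ∨ rel ord y x
  antisymm : ∀ x y, rel ord x y → rel ord y x → x = y
  trans : ∀ x y z, rel ord x y → rel ord y z → rel ord x z

namespace BinStruct

variable {m : ℕ} {M : Type*} (S : BinStruct m M)

/-- The distinguished linear order. -/
def le (x y : M) : Prop := S.rel S.ord x y

/-- An automorphism: a bijection of `M` preserving all the relations. -/
def IsAuto (σ : M ≃ M) : Prop :=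
  ∀ i x y, S.rel i x y ↔ S.rel i (σ x) (σ y)

/-- Homogeneity: every isomorphism between finite substructures extends to an automorphism. -/
def Homogeneous : Prop :=
  ∀ (A : Finset M) (f : M → M), Set.InjOn f A →
    (∀ i, ∀ x ∈ A, ∀ y ∈ A, (S.rel i x y ↔ S.rel i (f x) (f y))) →
    ∃ σ : M ≃ M, S.IsAuto σ ∧ ∀ a ∈ A, σ a = f a

/-- A binary relation is ∅-definable iff it is invariant under all automorphisms. -/
def Definable (R : M → M → Prop) : Prop :=
  ∀ σ : M ≃ M, S.IsAuto σ → ∀ x y, R x y ↔ R (σ x) (σ y)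

/-- `E` is `≤`-convex: every `E`-class is an interval with respect to `≤`. -/
def Convex (E : M → M → Prop) : Prop :=
  ∀ x y z, S.le x y → S.le y z → E x z → E x y

/-- The automorphism group acts transitively on `M`. -/
def TransAction : Prop := ∀ x y : M, ∃ σ : M ≃ M, S.IsAuto σ ∧ σ x = y

/-- The pairs `(a,b)` and `(c,d)` lie in the same orbit of the automorphism group. -/
def SamePairOrbit (a b c d : M) : Prop := ∃ σ : M ≃ M, S.IsAuto σ ∧ σ a = c ∧ σ b = d

/-- `M` is order-like: whenever `(a,b)` and `(b,c)` lie in the same orbit of the automorphism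
group acting on `M × M`, the pair `(a,c)` also lies in that orbit. -/
def OrderLike : Prop := ∀ a b c : M, S.SamePairOrbit a b b c → S.SamePairOrbit a b a c

/-- A cut of `(M, ≤)`: a nonempty, proper, downward closed subset with no greatest element. -/
def IsCut (C : Set M) : Prop :=
  C.Nonempty ∧ C ≠ Set.univ ∧ (∀ x y, S.le x y → y ∈ C → x ∈ C) ∧
    (∀ x ∈ C, ∃ y ∈ C, S.le x y ∧ x ≠ y)

end BinStruct

/-- A strict weak order `lt` on `M` with a labelling `tp` of pairs by 2-types, such that triples are
homogeneous under the set `G` of permutations, every type is a transitive relation, and there is no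
proper invariant convex equivalence relation strictly coarser than `lt`-incomparability. -/
structure OrderTypes {M T : Type*} (G : (M ≃ M) → Prop) (lt : M → M → Prop) (tp : M → M → T) :
    Prop where
  irrefl : ∀ a, ¬ lt a a
  trans : ∀ {a b c}, lt a b → lt b c → lt a c
  split : ∀ {a c} b, lt a c → lt a b ∨ lt b c
  symm_mem : ∀ {σ : M ≃ M}, G σ → G σ.symm
  map_lt : ∀ {σ : M ≃ M} {a b}, G σ → lt a b → lt (σ a) (σ b)
  map_tp : ∀ {σ : M ≃ M} a b, G σ → tp (σ a) (σ b) = tp a b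
  ext : ∀ {a b c a' b' c'}, tp a b = tp a' b' → tp a c = tp a' c' → tp b c = tp b' c' →
    ∃ σ : M ≃ M, G σ ∧ σ a = a' ∧ σ b = b' ∧ σ c = c'
  ext₂ : ∀ {a b a' b'}, tp a b = tp a' b' → ∃ σ : M ≃ M, G σ ∧ σ a = a' ∧ σ b = b'
  transitive : ∀ a b, ∃ σ : M ≃ M, G σ ∧ σ a = b
  orderLike : ∀ {a b c}, tp a b = tp b c → tp a c = tp a b
  coarsest : ∀ K : M → M → Prop, Equivalence K → (∀ σ : M ≃ M, G σ → ∀ a b, K a b → K (σ a) (σ b)) →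
    (∀ a b c, K a c → lt a b → lt b c → K a b) → (∀ a b, ¬ lt a b → ¬ lt b a → K a b) →
    (∀ a b, K a b) ∨ ∀ a b, K a b → ¬ lt a b

namespace OrderTypes

variable {M T : Type*} {G : (M ≃ M) → Prop} {lt : M → M → Prop} {tp : M → M → T}

theorem reverse (h : OrderTypes G lt tp) :
    OrderTypes G (fun a b => lt b a) (fun a b => tp b a) where
  irrefl := h.irrefl
  trans h₁ h₂ := h.trans h₂ h₁
  split b hac := (h.split b hac).symm
  symm_mem := h.symm_mem
  map_lt hσ hab := h.map_lt hσ hab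
  map_tp a b hσ := h.map_tp b a hσ
  ext h₁ h₂ h₃ := by
    obtain ⟨σ, hσ, hc, hb, ha⟩ := h.ext h₃ h₂ h₁
    exact ⟨σ, hσ, ha, hb, hc⟩
  ext₂ h₁ := by
    obtain ⟨σ, hσ, hb, ha⟩ := h.ext₂ h₁
    exact ⟨σ, hσ, ha, hb⟩
  transitive := h.transitive
  orderLike h₁ := (h.orderLike h₁.symm).trans h₁.symm
  coarsest K hK hinv hconv hinc := by
    rcases h.coarsest K hK hinv
      (fun a b c hac hab hbc => hK.trans hac (hconv c b a (hK.symm hac) hbc hab))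
      (fun a b h₁ h₂ => hinc a b h₂ h₁) with hall | hnone
    · exact Or.inl hall
    · exact Or.inr fun a b hab => hnone b a (hK.symm hab)

theorem lt_of_tp (h : OrderTypes G lt tp) {a b a' b' : M} (htp : tp a b = tp a' b')
    (hab : lt a b) : lt a' b' := by
  obtain ⟨σ, hσ, rfl, rfl⟩ := h.ext₂ htp
  exact h.map_lt hσ hab

theorem exists_right (h : OrderTypes G lt tp) (a b c : M) : ∃ d, tp c d = tp a b := by
  obtain ⟨σ, hσ, rfl⟩ := h.transitive a c
  exact ⟨σ b, h.map_tp a b hσ⟩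

theorem exists_left (h : OrderTypes G lt tp) (a b c : M) : ∃ d, tp d c = tp a b := by
  obtain ⟨σ, hσ, rfl⟩ := h.transitive b c
  exact ⟨σ a, h.map_tp a b hσ⟩

/-- The initial segment lying strictly below some element of every type above `a`. -/
def segment (lt : M → M → Prop) (tp : M → M → T) (a y : M) : Prop :=
  ∀ d, lt a d → ∃ d', tp a d' = tp a d ∧ lt y d'

theorem segment_map (h : OrderTypes G lt tp) {σ : M ≃ M} (hσ : G σ) {a y : M}
    (hy : segment lt tp a y) : segment lt tp (σ a) (σ y) := by
  intro d hd
  have hd' := h.map_lt (h.symm_mem hσ) hd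
  rw [Equiv.symm_apply_apply] at hd'
  obtain ⟨e, he, hye⟩ := hy _ hd'
  refine ⟨σ e, ?_, h.map_lt hσ hye⟩
  rw [h.map_tp _ _ hσ, he, ← h.map_tp _ _ hσ, Equiv.apply_symm_apply]

theorem segment_of_tp (h : OrderTypes G lt tp) {a b a' b' : M} (htp : tp a b = tp a' b')
    (hab : segment lt tp a b) : segment lt tp a' b' := by
  obtain ⟨σ, hσ, rfl, rfl⟩ := h.ext₂ htp
  exact h.segment_map hσ hab

theorem segment_self (a : M) : segment lt tp a a :=
  fun d hd => ⟨d, rfl, hd⟩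

theorem segment_down (h : OrderTypes G lt tp) {a y z : M} (hy : segment lt tp a y)
    (hyz : ¬ lt y z) : segment lt tp a z := by
  intro d hd
  obtain ⟨d', hd', hlt⟩ := hy d hd
  exact ⟨d', hd', (h.split z hlt).resolve_left hyz⟩

theorem lt_of_segment (h : OrderTypes G lt tp) {a y z : M} (hy : segment lt tp a y)
    (hz : ¬ segment lt tp a z) : lt y z := by
  by_contra hyz
  exact hz (h.segment_down hy hyz)

theorem exists_lt_segment (h : OrderTypes G lt tp) [Finite T] {a b : M} (hab : lt a b) :
    ∃ d, lt a d ∧ segment lt tp a d := by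
  let U : T → Set M := fun t => {y | ∃ d', tp a d' = t ∧ lt y d'}
  obtain ⟨t, ⟨d, had, rfl⟩, hmin⟩ := (Set.toFinite {t | ∃ d, lt a d ∧ tp a d = t}).exists_minimalFor
    U _ ⟨tp a b, b, hab, rfl⟩
  refine ⟨d, had, fun e hae => ?_⟩
  obtain ⟨d', hd'⟩ := h.exists_right a d d
  have hdd' : lt d d' := h.lt_of_tp hd'.symm had
  have hd : d ∈ U (tp a d) := ⟨d', h.orderLike hd'.symm, hdd'⟩
  by_contra hne
  have hle : U (tp a e) ≤ U (tp a d) := by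
    rintro z ⟨e', he', hz⟩
    rcases h.split d hz with hzd | hde
    · exact ⟨d, rfl, hzd⟩
    · exact absurd ⟨e', he', hde⟩ hne
  exact hne (hmin ⟨e, hae, rfl⟩ hle hd)

theorem segment_of_tp_eq (h : OrderTypes G lt tp) {a b b' : M} (hb : segment lt tp a b)
    (htp : tp a b' = tp a b) : segment lt tp a b' :=
  h.segment_of_tp htp.symm hb

theorem segment_subset (h : OrderTypes G lt tp) {a b y : M} (hab : lt a b)
    (hb : segment lt tp a b) (hy : segment lt tp b y) : segment lt tp a y := by
  obtain ⟨c, hc⟩ := h.exists_right a b b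
  obtain ⟨d, hd, hyd⟩ := hy c (h.lt_of_tp hc.symm hab)
  exact h.segment_down (h.segment_of_tp_eq hb (h.orderLike (hc.symm.trans hd.symm)))
    fun hdy => h.irrefl _ (h.trans hdy hyd)

theorem segment_subset_of_incomparable (h : OrderTypes G lt tp) [Finite T] {a b e : M}
    (hab : ¬ lt a b) (hba : ¬ lt b a) (he : segment lt tp b e) : segment lt tp a e := by
  by_contra hae
  have hlt_ae := h.lt_of_segment (segment_self a) hae
  obtain ⟨d, had, hd⟩ := h.exists_lt_segment hlt_ae
  have hbd : lt b d := (h.split b had).resolve_left hab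
  obtain ⟨b₁, hb₁, heb₁⟩ := he d hbd
  obtain ⟨x, hx⟩ := h.exists_left b d b
  have hxd : tp b d = tp x d := by rw [h.orderLike hx, hx]
  have hxb₁ : tp b b₁ = tp x b₁ := by rw [h.orderLike (hx.trans hb₁.symm), hx, hb₁]
  obtain ⟨σ, hσ, hσb, hσd, hσb₁⟩ := h.ext hxd hxb₁ rfl
  have hxb : lt x b := h.lt_of_tp hx.symm hbd
  have hσa_d : segment lt tp (σ a) d := hσd ▸ h.segment_map hσ hd
  have hσa_b₁ : ¬ segment lt tp (σ a) b₁ := by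
    intro hs
    have := h.segment_map (h.symm_mem hσ) hs
    rw [Equiv.symm_apply_apply, ← hσb₁, Equiv.symm_apply_apply] at this
    exact hae (h.segment_down this fun hlt => h.irrefl _ (h.trans hlt heb₁))
  have hσab : lt (σ a) b := by
    refine (h.split (σ a) hxb).resolve_left fun hlt => hba ?_
    have := h.map_lt (h.symm_mem hσ) hlt
    rwa [Equiv.symm_apply_apply, ← hσb, Equiv.symm_apply_apply] at this
  have hbe : segment lt tp b d :=
    h.segment_down he fun hlt => hae (h.segment_down hd fun h' => h.irrefl _ (h.trans hlt h'))
  have hb₁_mem : segment lt tp b b₁ := h.segment_of_tp_eq hbe hb₁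
  exact hσa_b₁ (h.segment_subset hσab
    (h.segment_down hσa_d fun hdb => h.irrefl _ (h.trans hdb hbd)) hb₁_mem)

theorem segment_subset_of_segment (h : OrderTypes G lt tp) {a b e : M} (hab : lt a b)
    (hb : segment lt tp a b) (he : segment lt tp a e) : segment lt tp b e := by
  by_contra hne
  obtain ⟨c, hc, hec⟩ := he b hab
  obtain ⟨y, hy⟩ := h.exists_right a b c
  obtain ⟨w, hw⟩ := h.exists_right a b b
  have haw : tp a w = tp a b := h.orderLike hw.symm
  have hay : tp a y = tp a b := (h.orderLike (hc.trans hy.symm)).trans hc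
  have hbw : lt b w := h.lt_of_tp hw.symm hab
  have hbw_mem : segment lt tp b w := h.segment_of_tp hw.symm hb
  have hcy : lt c y := h.lt_of_tp hy.symm hab
  have hbc : ¬ segment lt tp b c := fun hs =>
    hne (h.segment_down hs fun hce => h.irrefl _ (h.trans hce hec))
  have hby : ¬ segment lt tp b y := fun hs =>
    hbc (h.segment_down hs fun hyc => h.irrefl _ (h.trans hyc hcy))
  have hwc : lt w c := h.lt_of_segment hbw_mem hbc
  obtain ⟨σ, hσ, hσa, hσy⟩ := h.ext₂ (hay.trans hw.symm)
  obtain ⟨τ, hτ, hτa, hτw⟩ := h.ext₂ (haw.trans hy.symm)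
  have hzw : tp (σ w) w = tp w y := by
    have := h.map_tp w y hσ
    rwa [hσy] at this
  have hyz : tp y (τ y) = tp w y := by
    have := h.map_tp w y hτ
    rwa [hτw] at this
  have hcz : tp c (τ y) = tp a b := by
    have := h.map_tp a y hτ
    rw [hτa] at this
    exact this.trans hay
  obtain ⟨ρ, hρ, hρz, hρw, hρy⟩ := h.ext (a' := w) (b' := y) (c' := τ y) hzw
    (((h.orderLike hzw).trans hzw).trans (h.orderLike hyz.symm).symm) hyz.symm
  have hbz : ¬ segment lt tp (ρ b) (τ y) := by
    intro hs
    have := h.segment_map (h.symm_mem hρ) hs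
    rw [← hρy, Equiv.symm_apply_apply, Equiv.symm_apply_apply] at this
    exact hby this
  have hbz' : lt b (σ w) := by
    refine h.lt_of_tp ?_ hab
    have := h.map_tp a w hσ
    rw [hσa] at this
    exact (this.trans haw).symm
  have hvc : lt (ρ b) c := by
    have := h.map_lt hρ hbz'
    rw [hρz] at this
    exact h.trans this hwc
  have hvy : segment lt tp (ρ b) y := hρw ▸ h.segment_map hρ hbw_mem
  exact hbz (h.segment_subset hvc
    (h.segment_down hvy fun hyc => h.irrefl _ (h.trans hyc hcy)) (h.segment_of_tp hcz.symm hb))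

theorem segment_iff_of_segment (h : OrderTypes G lt tp) {a b : M} (hab : lt a b)
    (hb : segment lt tp a b) (z : M) : segment lt tp a z ↔ segment lt tp b z :=
  ⟨h.segment_subset_of_segment hab hb, h.segment_subset hab hb⟩

theorem segment_univ (h : OrderTypes G lt tp) [Finite T] {a b : M} (hab : lt a b) (x y : M) :
    segment lt tp x y := by
  rcases h.coarsest (fun x y => ∀ z, segment lt tp x z ↔ segment lt tp y z)
    ⟨fun _ _ => Iff.rfl, fun hxy z => (hxy z).symm, fun hxy hyz z => (hxy z).trans (hyz z)⟩
    (fun σ hσ x y hxy z => by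
      have key : ∀ w, segment lt tp (σ w) z ↔ segment lt tp w (σ.symm z) := fun w =>
        ⟨fun hs => by simpa using h.segment_map (h.symm_mem hσ) hs,
          fun hs => by simpa using h.segment_map hσ hs⟩
      rw [key, key, hxy])
    (fun x y z hxz hxy hyz => h.segment_iff_of_segment hxy
      (h.segment_down ((hxz z).2 (segment_self z)) fun hzy => h.irrefl _ (h.trans hzy hyz)))
    (fun x y hxy hyx z => ⟨h.segment_subset_of_incomparable hyx hxy,
      h.segment_subset_of_incomparable hxy hyx⟩) with hall | hnone
  · exact (hall x y y).2 (segment_self y)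
  · obtain ⟨d, had, hd⟩ := h.exists_lt_segment hab
    exact absurd had (hnone a d (h.segment_iff_of_segment had hd))

theorem exists_gt (h : OrderTypes G lt tp) [Finite T] {a b : M} (hab : lt a b) (y : M) :
    ∃ b', tp a b' = tp a b ∧ lt y b' :=
  h.segment_univ hab a y b hab

theorem exists_lt (h : OrderTypes G lt tp) [Finite T] {a d : M} (b : M) (had : lt a d) :
    ∃ b', tp a b' = tp a b ∧ lt b' d := by
  obtain ⟨d', hd', hlt⟩ := h.exists_gt had b
  obtain ⟨σ, hσ, hσa, hσd⟩ := h.ext₂ hd'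
  refine ⟨σ b, ?_, hσd ▸ h.map_lt hσ hlt⟩
  have := h.map_tp a b hσ
  rwa [hσa] at this

theorem exists_between (h : OrderTypes G lt tp) [Finite T] {F : M → M → Prop}
    (hF : ∀ σ : M ≃ M, G σ → ∀ a b, F a b → F (σ a) (σ b)) {a b : M} (hab : lt a b) (hFab : F a b)
    {u v c : M} (huv : lt u v) (huc : ¬ lt u c) : ∃ z, F c z ∧ lt u z ∧ lt z v := by
  obtain ⟨d, hd⟩ := h.exists_right a b c
  have hcd : lt c d := h.lt_of_tp hd.symm hab
  have hF_tp : ∀ z, tp c z = tp c d → F c z := by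
    intro z hz
    obtain ⟨σ, hσ, rfl, rfl⟩ := h.ext₂ (hz.trans hd).symm
    exact hF σ hσ a b hFab
  have hcv : lt c v := (h.split c huv).resolve_left huc
  by_cases hcu : lt c u
  · obtain ⟨t, ht⟩ := h.exists_right c u u
    have hut : lt u t := h.lt_of_tp ht.symm hcu
    obtain ⟨u', hu', hu'v⟩ := h.exists_lt t huv
    obtain ⟨e, he, hue⟩ := h.exists_gt hcd u
    obtain ⟨u'', hu'', heu''⟩ := h.exists_gt hut e
    obtain ⟨σ, hσ, hσc, hσu, hσu''⟩ := h.ext (a := c) (b := u) (c := u'') (a' := c) (b' := u)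
      (c' := u') rfl
      ((h.orderLike (ht.symm.trans hu''.symm)).trans (h.orderLike (ht.symm.trans hu'.symm)).symm)
      (hu''.trans hu'.symm)
    exact ⟨σ e, by simpa [hσc] using hF σ hσ c e (hF_tp e he), by simpa [hσu] using h.map_lt hσ hue,
      h.trans (by simpa [hσu''] using h.map_lt hσ heu'') hu'v⟩
  · obtain ⟨z, hz, hzv⟩ := h.exists_lt d hcv
    exact ⟨z, hF_tp z hz, (h.split u (h.lt_of_tp hz.symm hcd)).resolve_left hcu, hzv⟩

end OrderTypes

namespace BinStruct

variable {m : ℕ} {M : Type*} (S : BinStruct m M)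

/-- The quantifier-free type of a pair. -/
def pairType (a b : M) : Fin m → Prop × Prop := fun i => (S.rel i a b, S.rel i b a)

theorem IsAuto.symm {S : BinStruct m M} {σ : M ≃ M} (hσ : S.IsAuto σ) : S.IsAuto σ.symm := by
  intro i x y
  rw [hσ i (σ.symm x), Equiv.apply_symm_apply, Equiv.apply_symm_apply]

theorem IsAuto.pairType {S : BinStruct m M} {σ : M ≃ M} (hσ : S.IsAuto σ) (a b : M) :
    S.pairType (σ a) (σ b) = S.pairType a b := by
  funext i
  simp only [BinStruct.pairType, ← hσ i]

theorem le_refl (a : M) : S.le a a := (S.total a a).elim id id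

variable {S}

theorem rel_iff_of_pairType {a b a' b' : M} (h : S.pairType a b = S.pairType a' b') (i : Fin m) :
    (S.rel i a b ↔ S.rel i a' b') ∧ (S.rel i b a ↔ S.rel i b' a') := by
  have := congrFun h i
  simpa [pairType] using this

theorem eq_iff_of_pairType {a b a' b' : M} (h : S.pairType a b = S.pairType a' b') :
    a = b ↔ a' = b' := by
  have key : ∀ x y, x = y ↔ S.le x y ∧ S.le y x := fun x y =>
    ⟨by rintro rfl; exact ⟨S.le_refl x, S.le_refl x⟩, fun hxy => S.antisymm x y hxy.1 hxy.2⟩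
  rw [key, key]
  exact and_congr (rel_iff_of_pairType h S.ord).1 (rel_iff_of_pairType h S.ord).2

theorem exists_auto_of_pairType (hhom : S.Homogeneous) (htr : S.TransAction)
    {a b c a' b' c' : M} (hab : S.pairType a b = S.pairType a' b')
    (hac : S.pairType a c = S.pairType a' c') (hbc : S.pairType b c = S.pairType b' c') :
    ∃ σ : M ≃ M, S.IsAuto σ ∧ σ a = a' ∧ σ b = b' ∧ σ c = c' := by
  classical
  have hdiag : ∀ i x y, S.rel i x x ↔ S.rel i y y := by
    intro i x y
    obtain ⟨σ, hσ, rfl⟩ := htr x y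
    exact hσ i x x
  let f : M → M := fun x => if x = a then a' else if x = b then b' else c'
  have hfa : f a = a' := if_pos rfl
  have hfb : f b = b' := by
    by_cases hba : b = a
    · have := (eq_iff_of_pairType hab).1 hba.symm
      simp [f, hba, this]
    · simp [f, hba]
  have hfc : f c = c' := by
    by_cases hca : c = a
    · have := (eq_iff_of_pairType hac).1 hca.symm
      simp [f, hca, this]
    · by_cases hcb : c = b
      · have := (eq_iff_of_pairType hbc).1 hcb.symm
        simp only [f, hcb, if_true, this]
        rw [if_neg (fun hba => hca (hcb.trans hba))]
      · simp [f, hca, hcb]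
  obtain ⟨σ, hσ, hf⟩ := hhom {a, b, c} f
    (by
      intro x hx y hy hxy
      simp only [Finset.coe_insert, Finset.coe_singleton, Set.mem_insert_iff,
        Set.mem_singleton_iff] at hx hy
      have h₁ := eq_iff_of_pairType hab
      have h₂ := eq_iff_of_pairType hac
      have h₃ := eq_iff_of_pairType hbc
      rcases hx with rfl | rfl | rfl <;> rcases hy with rfl | rfl | rfl <;>
        simp only [hfa, hfb, hfc] at hxy <;> grind)
    (by
      intro i x hx y hy
      simp only [Finset.mem_insert, Finset.mem_singleton] at hx hy
      have h₁ := rel_iff_of_pairType hab i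
      have h₂ := rel_iff_of_pairType hac i
      have h₃ := rel_iff_of_pairType hbc i
      rcases hx with rfl | rfl | rfl <;> rcases hy with rfl | rfl | rfl <;>
        simp only [hfa, hfb, hfc] <;>
        first
          | exact hdiag i _ _
          | exact h₁.1
          | exact h₁.2
          | exact h₂.1
          | exact h₂.2
          | exact h₃.1
          | exact h₃.2)
  exact ⟨σ, hσ, (hf a (by simp)).trans hfa, (hf b (by simp)).trans hfb, (hf c (by simp)).trans hfc⟩

theorem convex_left {E : M → M → Prop} (hE : Equivalence E) (hconv : S.Convex E) {x y z : M}
    (hxy : S.le x y) (hyz : S.le y z) (hxz : E x z) : E y z :=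
  hE.trans (hE.symm (hconv x y z hxy hyz hxz)) hxz

theorem orderTypes (hhom : S.Homogeneous) (hol : S.OrderLike) (htr : S.TransAction)
    {E : M → M → Prop} (hEdef : S.Definable E) (hEequiv : Equivalence E) (hEconv : S.Convex E)
    (hEcoarsest : ∀ F : M → M → Prop, S.Definable F → Equivalence F → S.Convex F →
      (¬ ∀ x y, F x y) → ∀ x y, F x y → E x y) :
    OrderTypes S.IsAuto (fun a b => S.le a b ∧ ¬ E a b) S.pairType where
  irrefl a h := h.2 (hEequiv.refl a)
  trans {a b c} h₁ h₂ :=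
    ⟨S.trans a b c h₁.1 h₂.1, fun h => h₁.2 (hEconv a b c h₁.1 h₂.1 h)⟩
  split {a c} b h := by
    by_contra! hne
    have hcontra : ∀ x y, ¬ S.le x y → S.le y x := fun x y => (S.total x y).resolve_left
    by_cases hab : S.le a b
    · by_cases hbc : S.le b c
      · exact h.2 (hEequiv.trans (hne.1 hab) (hne.2 hbc))
      · exact h.2 (hEconv a c b h.1 (hcontra b c hbc) (hne.1 hab))
    · have hba := hcontra a b hab
      exact h.2 (convex_left hEequiv hEconv hba h.1 (hne.2 (S.trans b a c hba h.1)))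
  symm_mem hσ := hσ.symm
  map_lt {σ a b} hσ h := ⟨(hσ S.ord a b).1 h.1, fun h' => h.2 ((hEdef σ hσ a b).2 h')⟩
  map_tp a b hσ := hσ.pairType a b
  ext := exists_auto_of_pairType hhom htr
  ext₂ {a b a' b'} h := by
    have hdiag : S.pairType b b = S.pairType b' b' := by
      obtain ⟨σ, hσ, rfl⟩ := htr b b'
      exact (hσ.pairType b b).symm
    obtain ⟨σ, hσ, ha, hb, -⟩ := exists_auto_of_pairType hhom htr h h hdiag
    exact ⟨σ, hσ, ha, hb⟩
  transitive := htr
  orderLike {a b c} h := by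
    have hdiag : S.pairType b b = S.pairType c c := by
      obtain ⟨σ, hσ, rfl⟩ := htr b c
      exact (hσ.pairType b b).symm
    obtain ⟨σ, hσ, ha, hb, -⟩ := exists_auto_of_pairType hhom htr h h hdiag
    obtain ⟨τ, hτ, ha', rfl⟩ := hol a b c ⟨σ, hσ, ha, hb⟩
    rw [← hτ.pairType a b, ha']
  coarsest K hK hinv hconv hinc := by
    have hEK : ∀ a b, E a b → K a b := fun a b h =>
      hinc a b (fun h' => h'.2 h) fun h' => h'.2 (hEequiv.symm h)
    by_cases hall : ∀ a b, K a b
    · exact Or.inl hall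
    · refine Or.inr fun a b hab h => h.2 (hEcoarsest K ?_ hK ?_ hall a b hab)
      · intro σ hσ x y
        exact ⟨hinv σ hσ x y, fun h => by simpa using hinv σ.symm hσ.symm _ _ h⟩
      · intro x y z hxy hyz hxz
        by_cases h₁ : E x y
        · exact hEK x y h₁
        · by_cases h₂ : E y z
          · exact hK.trans hxz (hK.symm (hEK y z h₂))
          · exact hconv x y z hxz ⟨hxy, h₁⟩ ⟨hyz, h₂⟩

end BinStruct


/-- If `M` is a countably infinite homogeneous, order-like, transitive binary structure with a
distinguished linear order `≤`, `E` is the coarsest proper ∅-definable `≤`-convex equivalence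
relation, and `F` is a ∅-definable equivalence relation not refining `E`, then every `F`-class
intersects a dense set of `E`-classes. -/
theorem class_intersects_dense_set_of_classes
    {m : ℕ} {M : Type*} [Countable M] [Infinite M] (S : BinStruct m M)
    (hhom : S.Homogeneous) (hol : S.OrderLike) (htr : S.TransAction)
    (E : M → M → Prop) (hEdef : S.Definable E) (hEequiv : Equivalence E)
    (hEconv : S.Convex E) (hEproper : ¬ ∀ x y, E x y)
    (hEcoarsest : ∀ F : M → M → Prop, S.Definable F → Equivalence F → S.Convex F →
      (¬ ∀ x y, F x y) → ∀ x y, F x y → E x y)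
    (F : M → M → Prop) (hFdef : S.Definable F) (hFequiv : Equivalence F)
    (hFnotrefine : ¬ ∀ x y, F x y → E x y)
    (c : M) :
    ∀ u v, S.le u v → u ≠ v → ¬ E u v →
      ∃ z, F c z ∧ (S.le u z ∧ u ≠ z) ∧ (S.le z v ∧ z ≠ v) ∧ ¬ E z u ∧ ¬ E z v := by
  have h := S.orderTypes hhom hol htr hEdef hEequiv hEconv hEcoarsest
  have hF : ∀ σ : M ≃ M, S.IsAuto σ → ∀ a b, F a b → F (σ a) (σ b) :=
    fun σ hσ a b => (hFdef σ hσ a b).1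
  obtain ⟨a, b, hle, hE, hFab⟩ : ∃ a b, S.le a b ∧ ¬ E a b ∧ F a b := by
    push Not at hFnotrefine
    obtain ⟨x, y, hxy, hE⟩ := hFnotrefine
    rcases S.total x y with hle | hle
    · exact ⟨x, y, hle, hE, hxy⟩
    · exact ⟨y, x, hle, fun h' => hE (hEequiv.symm h'), hFequiv.symm hxy⟩
  intro u v huv _ hEuv
  obtain ⟨z, hz, huz, hzv⟩ : ∃ z, F c z ∧ (S.le u z ∧ ¬ E u z) ∧ (S.le z v ∧ ¬ E z v) := by
    by_cases huc : S.le u c ∧ ¬ E u c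
    · by_cases hcv : S.le c v ∧ ¬ E c v
      · exact ⟨c, hFequiv.refl c, huc, hcv⟩
      · obtain ⟨z, hz, hzv, huz⟩ := h.reverse.exists_between hF (a := b) (b := a) ⟨hle, hE⟩
          (hFequiv.symm hFab) (u := v) (v := u) ⟨huv, hEuv⟩ hcv
        exact ⟨z, hz, huz, hzv⟩
    · exact h.exists_between hF ⟨hle, hE⟩ hFab ⟨huv, hEuv⟩ huc
  exact ⟨z, hz, ⟨huz.1, fun h' => huz.2 (h' ▸ hEequiv.refl u)⟩,
    ⟨hzv.1, fun h' => hzv.2 (h' ▸ hEequiv.refl z)⟩, fun h' => huz.2 (hEequiv.symm h'), hzv.2⟩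
end

section
/- Let M be a set with a group G acting transitively on M, such that M is order-like (types over ∅ being identified with G-orbits). Let E and F be G-invariant equivalence relations on M. If a, a', b ∈ M satisfy a E a' and a F b, then there exists b' ∈ M with b E b' and a' F b'. -/
/-- Let `G` act transitively on `M`, with `M` order-like (types over ∅ identified with
`G`-orbits), and let `E`, `F` be `G`-invariant equivalence relations. If `a E a'` and `a F b`,
then there is `b'` with `b E b'` and `a' F b'`. -/
theorem order_like_two_relations
    {G M : Type*} [Group G] [MulAction G M]
    (htrans : ∀ x y : M, ∃ g : G, g • x = y)
    (horderlike : ∀ a b c : M, (∃ g : G, g • a = b ∧ g • b = c) →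
      ∃ g : G, g • a = a ∧ g • b = c)
    (E F : M → M → Prop) (hEequiv : Equivalence E) (hFequiv : Equivalence F)
    (hEinv : ∀ (g : G) (x y : M), E x y ↔ E (g • x) (g • y))
    (hFinv : ∀ (g : G) (x y : M), F x y ↔ F (g • x) (g • y))
    (a a' b : M) (haa' : E a a') (hab : F a b) :
    ∃ b', E b b' ∧ F a' b' := by
  obtain ⟨k, hk⟩ := htrans a a'
  obtain ⟨l, hl⟩ := htrans a b
  obtain ⟨h, hha, hh⟩ := horderlike a ((k * l⁻¹) • a) ((k * l⁻¹) • (k * l⁻¹) • a)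
    ⟨k * l⁻¹, rfl, rfl⟩
  obtain ⟨u, hu⟩ : ∃ u : G, u = (k * l⁻¹)⁻¹ * (k * l⁻¹)⁻¹ * h * (k * l⁻¹) := ⟨_, rfl⟩
  have hua : u • a = a := by
    rw [hu, mul_smul, mul_smul, hh, mul_smul, inv_smul_smul, inv_smul_smul]
  have hprod : k * l⁻¹ * u * l = l * k⁻¹ * h * k := by rw [hu]; group
  refine ⟨(k * l⁻¹ * u * l) • a, ?_, ?_⟩
  · have hE : E a' (h • a') := by
      have hstab := (hEinv h a a').1 haa'
      rw [hha] at hstab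
      exact hEequiv.trans (hEequiv.symm haa') hstab
    have hE' := (hEinv (l * k⁻¹) _ _).1 hE
    rw [hprod]
    simpa [← hk, ← hl, mul_smul] using hE'
  · have hF : F b (u • b) := by
      have hstab := (hFinv u a b).1 hab
      rw [hua] at hstab
      exact hFequiv.trans (hFequiv.symm hab) hstab
    have hF' := (hFinv (k * l⁻¹) _ _).1 hF
    simpa [← hk, ← hl, mul_smul] using hF'
end

section
/- Let M be a set with a group G acting transitively on M, such that M is order-like (types over ∅ being identified with G-orbits). Let E and F be G-invariant equivalence relations on M whose join (in the lattice of equivalence relations, i.e., the transitive closure of E ∪ F) is the trivial (universal) relation. Then E and F are cross-cutting: every E-class intersects every F-class. -/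
/-- For an order-like transitive action, any two invariant equivalence relations `E` and `F`
satisfy `F ∘ E ⊆ E ∘ F`. -/
theorem exists_swap_of_orderLike
    {G M : Type*} [Group G] [MulAction G M]
    (htrans : ∀ x y : M, ∃ g : G, g • x = y)
    (horderlike : ∀ a b c : M, (∃ g : G, g • a = b ∧ g • b = c) →
      ∃ g : G, g • a = a ∧ g • b = c)
    {E F : M → M → Prop} (hEequiv : Equivalence E) (hFequiv : Equivalence F)
    (hEinv : ∀ (g : G) (x y : M), E x y ↔ E (g • x) (g • y))
    (hFinv : ∀ (g : G) (x y : M), F x y ↔ F (g • x) (g • y))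
    {x y z : M} (hxy : F x y) (hyz : E y z) : ∃ w, E x w ∧ F w z := by
  obtain ⟨g, rfl⟩ := htrans x z
  obtain ⟨h, hfix, hmap⟩ := horderlike (g⁻¹ • y) y (g • y) ⟨g, smul_inv_smul g y, rfl⟩
  have hax : E (g⁻¹ • y) x := (hEinv g _ _).2 (by rwa [smul_inv_smul])
  have hahx : E (g⁻¹ • y) (h • x) := hfix ▸ (hEinv h _ _).1 hax
  exact ⟨h • x, hEequiv.trans (hEequiv.symm hax) hahx,
    hFequiv.trans (hmap ▸ (hFinv h _ _).1 hxy) (hFequiv.symm ((hFinv g _ _).1 hxy))⟩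

/-- Let `G` act transitively on `M`, with `M` order-like (types over ∅ identified with
`G`-orbits), and let `E`, `F` be `G`-invariant equivalence relations whose join (the transitive
closure of their union) is the trivial relation. Then `E` and `F` are cross-cutting: every
`E`-class intersects every `F`-class. -/
theorem order_like_cross_cutting
    {G M : Type*} [Group G] [MulAction G M]
    (htrans : ∀ x y : M, ∃ g : G, g • x = y)
    (horderlike : ∀ a b c : M, (∃ g : G, g • a = b ∧ g • b = c) →
      ∃ g : G, g • a = a ∧ g • b = c)
    (E F : M → M → Prop) (hEequiv : Equivalence E) (hFequiv : Equivalence F)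
    (hEinv : ∀ (g : G) (x y : M), E x y ↔ E (g • x) (g • y))
    (hFinv : ∀ (g : G) (x y : M), F x y ↔ F (g • x) (g • y))
    (hjoin : ∀ x y : M, Relation.TransGen (fun u v => E u v ∨ F u v) x y) :
    ∀ x y : M, ∃ z, E x z ∧ F y z := by
  intro x y
  suffices h : ∃ z, E x z ∧ F z y from h.imp fun z hz => ⟨hz.1, hFequiv.symm hz.2⟩
  have hsteps := (hjoin x y).to_reflTransGen
  induction hsteps with
  | refl => exact ⟨x, hEequiv.refl x, hFequiv.refl x⟩
  | tail _ hstep ih =>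
    obtain ⟨z, hxz, hzu⟩ := ih
    rcases hstep with hE | hF
    · obtain ⟨w, hzw, hwv⟩ := exists_swap_of_orderLike htrans horderlike hEequiv hFequiv
        hEinv hFinv hzu hE
      exact ⟨w, hEequiv.trans hxz hzw, hwv⟩
    · exact ⟨z, hxz, hFequiv.trans hzu hF⟩
end

section
/- Let (Γ; ≤₁, …, ≤ₙ) be a homogeneous n-dimensional permutation structure with n ≥ 2, and let F be a maximal ∅-definable equivalence relation on Γ, i.e., F is not the trivial relation and the only ∅-definable equivalence relation strictly coarser than F is the trivial relation. Then F is convex with respect to at least two of the orders in the language: there exist distinct i, j ≤ n such that F is ≤ᵢ-convex and ≤ⱼ-convex. -/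
/-- An `n`-dimensional permutation structure: a set `Γ` equipped with `n` linear orders. -/
structure PermStruct (n : ℕ) (Γ : Type*) where
  le : Fin n → Γ → Γ → Prop
  total : ∀ i x y, le i x y ∨ le i y x
  antisymm : ∀ i x y, le i x y → le i y x → x = y
  trans : ∀ i x y z, le i x y → le i y z → le i x z

namespace PermStruct

variable {n : ℕ} {Γ : Type*} (S : PermStruct n Γ)

/-- An automorphism of the permutation structure: a bijection of `Γ` preserving each order. -/
def IsAuto (σ : Γ ≃ Γ) : Prop :=
  ∀ i x y, S.le i x y ↔ S.le i (σ x) (σ y)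

/-- Homogeneity: every isomorphism between finite substructures (i.e. every bijection between
finite subsets preserving each order) extends to an automorphism. -/
def Homogeneous : Prop :=
  ∀ (A : Finset Γ) (f : Γ → Γ), Set.InjOn f A →
    (∀ i, ∀ x ∈ A, ∀ y ∈ A, (S.le i x y ↔ S.le i (f x) (f y))) →
    ∃ σ : Γ ≃ Γ, S.IsAuto σ ∧ ∀ a ∈ A, σ a = f a

/-- A binary relation is ∅-definable iff it is invariant under all automorphisms. -/
def Definable (R : Γ → Γ → Prop) : Prop :=
  ∀ σ : Γ ≃ Γ, S.IsAuto σ → ∀ x y, R x y ↔ R (σ x) (σ y)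

/-- `E` is `≤ᵢ`-convex: every `E`-class is an interval with respect to `≤ᵢ`. -/
def Convex (i : Fin n) (E : Γ → Γ → Prop) : Prop :=
  ∀ x y z, S.le i x y → S.le i y z → E x z → E x y

end PermStruct

namespace PermStruct

variable {n : ℕ} {Γ : Type*} {S : PermStruct n Γ}

/-! ### Two-types -/

/-- `S.HasType a x y` says that `x ≠ y` and that the sign vector of the pair `(x, y)` is `a`. -/
def HasType (S : PermStruct n Γ) (a : Fin n → Prop) (x y : Γ) : Prop :=
  x ≠ y ∧ ∀ i, S.le i x y ↔ a i

lemma le_refl (S : PermStruct n Γ) (i : Fin n) (x : Γ) : S.le i x x :=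
  (S.total i x x).elim id id

lemma hasType_self {x y : Γ} (h : x ≠ y) : S.HasType (fun i => S.le i x y) x y :=
  ⟨h, fun _ => Iff.rfl⟩

lemma HasType.le_symm_iff {a : Fin n → Prop} {x y : Γ} (h : S.HasType a x y) (i : Fin n) :
    S.le i y x ↔ ¬ a i := by
  rw [← h.2 i]
  constructor
  · intro h1 h2
    exact h.1 (S.antisymm i _ _ h2 h1)
  · intro h1
    exact (S.total i x y).resolve_left h1

/-- Every two-type is a transitive relation. -/
lemma HasType.trans (hn : 2 ≤ n) {a : Fin n → Prop} {x y z : Γ} (h₁ : S.HasType a x y)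
    (h₂ : S.HasType a y z) : S.HasType a x z := by
  have hne : x ≠ z := by
    rintro rfl
    have h := (h₁.le_symm_iff ⟨0, by omega⟩).symm.trans (h₂.2 ⟨0, by omega⟩)
    exact (iff_not_self h.symm)
  refine ⟨hne, fun i => ⟨fun h => ?_, fun h => ?_⟩⟩
  · by_contra hi
    exact hne (S.antisymm i _ _ h (S.trans i _ _ _ ((h₂.le_symm_iff i).2 hi)
      ((h₁.le_symm_iff i).2 hi)))
  · exact S.trans i _ _ _ ((h₁.2 i).2 h) ((h₂.2 i).2 h)

lemma IsAuto.symm {σ : Γ ≃ Γ} (h : S.IsAuto σ) : S.IsAuto σ.symm := fun i x y => by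
  simpa using (h i (σ.symm x) (σ.symm y)).symm

lemma IsAuto.hasType {σ : Γ ≃ Γ} (h : S.IsAuto σ) {a : Fin n → Prop} {x y : Γ}
    (hxy : S.HasType a x y) : S.HasType a (σ x) (σ y) :=
  ⟨fun e => hxy.1 (σ.injective e), fun i => (h i x y).symm.trans (hxy.2 i)⟩

lemma definable_of_imp {R : Γ → Γ → Prop}
    (h : ∀ σ : Γ ≃ Γ, S.IsAuto σ → ∀ x y, R x y → R (σ x) (σ y)) : S.Definable R :=
  fun σ hσ x y => ⟨h σ hσ x y, fun hR => by simpa using h σ.symm hσ.symm _ _ hR⟩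

lemma definable_le (i : Fin n) : S.Definable (S.le i) := fun _ hσ x y => hσ i x y

lemma Homogeneous.exists_auto (hS : S.Homogeneous) (x y : Γ) :
    ∃ σ : Γ ≃ Γ, S.IsAuto σ ∧ σ x = y := by
  obtain ⟨σ, hσ, h⟩ := hS {x} (fun _ => y) (by simp) (by simp [S.le_refl])
  exact ⟨σ, hσ, h x (by simp)⟩

open Classical in
lemma Homogeneous.exists_auto_triple (hS : S.Homogeneous) {a : Fin n → Prop} {x y z x' y' z' : Γ}
    (hxy : S.HasType a x y) (hxz : S.HasType a x z) (hyz : S.HasType a y z)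
    (hxy' : S.HasType a x' y') (hxz' : S.HasType a x' z') (hyz' : S.HasType a y' z') :
    ∃ σ : Γ ≃ Γ, S.IsAuto σ ∧ σ x = x' ∧ σ y = y' ∧ σ z = z' := by
  have e₁ := hxy.1
  have e₂ := hxz.1
  have e₃ := hyz.1
  set f : Γ → Γ := fun u => if u = x then x' else if u = y then y' else z' with hf
  have fx : f x = x' := by simp [hf]
  have fy : f y = y' := by simp [hf, e₁.symm]
  have fz : f z = z' := by simp [hf, e₂.symm, e₃.symm]
  obtain ⟨σ, hσ, h⟩ := hS {x, y, z} f (by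
      intro u hu v hv huv
      simp only [Finset.coe_insert, Finset.coe_singleton, Set.mem_insert_iff,
        Set.mem_singleton_iff] at hu hv
      rcases hu with hu | hu | hu <;> rcases hv with hv | hv | hv <;>
        simp only [hu, hv, fx, fy, fz] at huv ⊢
      exacts [(hxy'.1 huv).elim, (hxz'.1 huv).elim, (hxy'.1 huv.symm).elim, (hyz'.1 huv).elim,
        (hxz'.1 huv.symm).elim, (hyz'.1 huv.symm).elim]) (by
      intro i u hu v hv
      simp only [Finset.mem_insert, Finset.mem_singleton] at hu hv
      rcases hu with hu | hu | hu <;> rcases hv with hv | hv | hv <;>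
        simp only [hu, hv, fx, fy, fz, S.le_refl i, hxy.2 i, hxz.2 i, hyz.2 i, hxy'.2 i,
          hxz'.2 i, hyz'.2 i, hxy.le_symm_iff i, hxz.le_symm_iff i, hyz.le_symm_iff i,
          hxy'.le_symm_iff i, hxz'.le_symm_iff i, hyz'.le_symm_iff i])
  exact ⟨σ, hσ, (h x (by simp)).trans fx, (h y (by simp)).trans fy, (h z (by simp)).trans fz⟩

open Classical in
lemma Homogeneous.exists_auto_pair (hS : S.Homogeneous) {a : Fin n → Prop} {x y x' y' : Γ}
    (h : S.HasType a x y) (h' : S.HasType a x' y') :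
    ∃ σ : Γ ≃ Γ, S.IsAuto σ ∧ σ x = x' ∧ σ y = y' := by
  have e := h.1
  set f : Γ → Γ := fun u => if u = x then x' else y' with hf
  have fx : f x = x' := by simp [hf]
  have fy : f y = y' := by simp [hf, e.symm]
  obtain ⟨σ, hσ, h⟩ := hS {x, y} f (by
      intro u hu v hv huv
      simp only [Finset.coe_insert, Finset.coe_singleton, Set.mem_insert_iff,
        Set.mem_singleton_iff] at hu hv
      rcases hu with hu | hu <;> rcases hv with hv | hv <;>
        simp only [hu, hv, fx, fy] at huv ⊢
      exacts [(h'.1 huv).elim, (h'.1 huv.symm).elim]) (by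
      intro i u hu v hv
      simp only [Finset.mem_insert, Finset.mem_singleton] at hu hv
      rcases hu with hu | hu <;> rcases hv with hv | hv <;>
        simp only [hu, hv, fx, fy, S.le_refl i, h.2 i, h'.2 i, h.le_symm_iff i,
          h'.le_symm_iff i])
  exact ⟨σ, hσ, (h x (by simp)).trans fx, (h y (by simp)).trans fy⟩

/-- A definable relation holding for one pair of a two-type holds for all pairs of that type. -/
lemma Definable.of_hasType {R : Γ → Γ → Prop} (hR : S.Definable R) (hS : S.Homogeneous)
    {a : Fin n → Prop} {x y x' y' : Γ} (h : S.HasType a x y) (h' : S.HasType a x' y')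
    (hxy : R x y) : R x' y' := by
  obtain ⟨σ, hσ, rfl, rfl⟩ := hS.exists_auto_pair h h'
  exact (hR σ hσ x y).1 hxy

lemma Homogeneous.exists_hasType (hS : S.Homogeneous) {a : Fin n → Prop} {x y : Γ}
    (h : S.HasType a x y) (x' : Γ) : ∃ y', S.HasType a x' y' := by
  obtain ⟨σ, hσ, rfl⟩ := hS.exists_auto x x'
  exact ⟨σ y, hσ.hasType h⟩

lemma Homogeneous.finite_definable (hS : S.Homogeneous) :
    {R : Γ → Γ → Prop | S.Definable R}.Finite := by
  let f : (Γ → Γ → Prop) → Set (Fin n → Prop) × Prop :=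
    fun R => ({a | ∃ x y, S.HasType a x y ∧ R x y}, ∃ x, R x x)
  have aux : ∀ R R' : Γ → Γ → Prop, S.Definable R' → f R = f R' → ∀ x y, R x y → R' x y := by
    intro R R' hR' hf x y hxy
    obtain ⟨h₁, h₂⟩ := Prod.ext_iff.1 hf
    by_cases e : x = y
    · subst e
      obtain ⟨u, hu⟩ : ∃ u, R' u u := by
        have : ∃ u, R u u := ⟨x, hxy⟩
        exact cast h₂ this
      obtain ⟨σ, hσ, rfl⟩ := hS.exists_auto u x
      exact (hR' σ hσ u u).1 hu
    · have h₃ : (fun i => S.le i x y) ∈ (f R').1 := h₁ ▸ ⟨x, y, hasType_self e, hxy⟩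
      obtain ⟨u, v, huv, hR⟩ := h₃
      exact hR'.of_hasType hS huv (hasType_self e) hR
  refine Set.Finite.of_finite_image (f := f) (Set.toFinite _) ?_
  intro R hR R' hR' h
  funext x y
  exact propext ⟨aux R R' hR' h x y, aux R' R hR h.symm x y⟩

/-! ### A Ramsey argument for laminar families -/

/-- `A` carries a binary tree of depth `d` whose branchings are separated by disjoint members
of the family `T`. -/
def Branching (T : Γ → Set Γ) : ℕ → Set Γ → Prop
  | 0, A => A.Nonempty
  | d + 1, A => ∃ z₁ z₂, Disjoint (T z₁) (T z₂) ∧ Branching T d (A ∩ T z₁) ∧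
      Branching T d (A ∩ T z₂)

/-- A tree as in `Branching` all of whose branchings have the same two-type `a`. -/
def MonoBranching (S : PermStruct n Γ) (T : Γ → Set Γ) (a : Fin n → Prop) : ℕ → Set Γ → Prop
  | 0, A => A.Nonempty
  | d + 1, A => ∃ z₁ z₂ A₁ A₂, A₁ ⊆ A ∩ T z₁ ∧ A₂ ⊆ A ∩ T z₂ ∧ Disjoint (T z₁) (T z₂) ∧
      (∀ x ∈ A₁, ∀ y ∈ A₂, S.HasType a x y) ∧ MonoBranching S T a d A₁ ∧
      MonoBranching S T a d A₂

variable {T : Γ → Set Γ}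

lemma Branching.mono {d : ℕ} {A B : Set Γ} (h : Branching T d A) (hAB : A ⊆ B) :
    Branching T d B := by
  induction d generalizing A B with
  | zero => exact Set.Nonempty.mono hAB h
  | succ d ih =>
    obtain ⟨z₁, z₂, hd, h₁, h₂⟩ := h
    exact ⟨z₁, z₂, hd, ih h₁ (Set.inter_subset_inter_left _ hAB),
      ih h₂ (Set.inter_subset_inter_left _ hAB)⟩

lemma MonoBranching.mono {a : Fin n → Prop} {d : ℕ} {A B : Set Γ} (h : MonoBranching S T a d A)
    (hAB : A ⊆ B) : MonoBranching S T a d B := by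
  cases d with
  | zero => exact Set.Nonempty.mono hAB h
  | succ d =>
    obtain ⟨z₁, z₂, A₁, A₂, h₁, h₂, h⟩ := h
    exact ⟨z₁, z₂, A₁, A₂, h₁.trans (Set.inter_subset_inter_left _ hAB),
      h₂.trans (Set.inter_subset_inter_left _ hAB), h⟩

lemma Branching.nonempty {d : ℕ} {A : Set Γ} (h : Branching T d A) : A.Nonempty := by
  induction d generalizing A with
  | zero => exact h
  | succ d ih =>
    obtain ⟨z₁, z₂, hd, h₁, h₂⟩ := h
    exact (ih h₁).mono Set.inter_subset_left

lemma MonoBranching.nonempty {a : Fin n → Prop} {d : ℕ} {A : Set Γ}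
    (h : MonoBranching S T a d A) : A.Nonempty := by
  induction d generalizing A with
  | zero => exact h
  | succ d ih =>
    obtain ⟨z₁, z₂, A₁, A₂, hA, -, -, -, h₁, -⟩ := h
    exact (ih h₁).mono (hA.trans Set.inter_subset_left)

lemma Branching.exists_finite {d : ℕ} {A : Set Γ} (h : Branching T d A) :
    ∃ B ⊆ A, B.Finite ∧ Branching T d B := by
  induction d generalizing A with
  | zero =>
    obtain ⟨x, hx⟩ := h
    exact ⟨{x}, by simpa using hx, Set.finite_singleton x, Set.singleton_nonempty x⟩
  | succ d ih =>
    obtain ⟨z₁, z₂, hd, h₁, h₂⟩ := h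
    obtain ⟨B₁, s₁, f₁, b₁⟩ := ih h₁
    obtain ⟨B₂, s₂, f₂, b₂⟩ := ih h₂
    refine ⟨B₁ ∪ B₂, Set.union_subset (s₁.trans Set.inter_subset_left)
      (s₂.trans Set.inter_subset_left), f₁.union f₂, z₁, z₂, hd, b₁.mono ?_, b₂.mono ?_⟩
    · exact Set.subset_inter Set.subset_union_left (s₁.trans Set.inter_subset_right)
    · exact Set.subset_inter Set.subset_union_right (s₂.trans Set.inter_subset_right)

lemma Branching.split {d e : ℕ} {A : Set Γ} (P : Set Γ) (h : Branching T (d + e) A) :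
    Branching T d (A ∩ P) ∨ Branching T e (A \ P) := by
  induction d generalizing e A with
  | zero =>
    by_cases hP : (A ∩ P).Nonempty
    · exact Or.inl hP
    · rw [zero_add] at h
      refine Or.inr (h.mono fun x hx => ⟨hx, fun hxP => hP ⟨x, hx, hxP⟩⟩)
  | succ d ihd =>
    induction e generalizing A with
    | zero =>
      by_cases hP : (A \ P).Nonempty
      · exact Or.inr hP
      · refine Or.inl (Branching.mono h fun x hx => ⟨hx, ?_⟩)
        by_contra hxP
        exact hP ⟨x, hx, hxP⟩
    | succ e _ =>
      have h' : Branching T ((d + (e + 1)) + 1) A := by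
        rwa [show d + (e + 1) + 1 = d + 1 + (e + 1) by omega]
      obtain ⟨z₁, z₂, hd, h₁, h₂⟩ := h'
      rcases ihd h₁ with h₁ | h₁
      · rcases ihd h₂ with h₂ | h₂
        · refine Or.inl ⟨z₁, z₂, hd, h₁.mono ?_, h₂.mono ?_⟩ <;>
          · rintro x ⟨⟨hx, hz⟩, hP⟩
            exact ⟨⟨hx, hP⟩, hz⟩
        · exact Or.inr (h₂.mono (Set.sdiff_subset_sdiff_left Set.inter_subset_left))
      · exact Or.inr (h₁.mono (Set.sdiff_subset_sdiff_left Set.inter_subset_left))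

/-- Two large sets have large subsets lying on opposite sides of a threshold for `≤ᵢ`. -/
lemma Branching.separate (S : PermStruct n Γ) (i : Fin n) {g : ℕ} {L R : Set Γ}
    (hL : Branching T (g + g) L) (hR : Branching T (g + g) R) :
    ∃ L' ⊆ L, ∃ R' ⊆ R, Branching T g L' ∧ Branching T g R' ∧
      ((∀ x ∈ L', ∀ y ∈ R', S.le i x y) ∨ (∀ x ∈ L', ∀ y ∈ R', S.le i y x)) := by
  classical
  let _ : LinearOrder Γ :=
    { le := S.le i
      le_refl := S.le_refl i
      le_trans := S.trans i
      le_antisymm := S.antisymm i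
      le_total := S.total i
      toDecidableLE := Classical.decRel _ }
  obtain ⟨B, hBL, hBf, hB⟩ := hL.exists_finite
  have aux : ∀ m, Branching T g (B ∩ Set.Iio m) → ∃ m' ∈ B, m' < m ∧
      Branching T g (B ∩ Set.Iic m') := by
    intro m hm
    obtain ⟨m', hm', hmax⟩ := Set.exists_max_image (B ∩ Set.Iio m) id
      (hBf.subset Set.inter_subset_left) hm.nonempty
    exact ⟨m', hm'.1, hm'.2, hm.mono fun x hx => ⟨hx.1, hmax x hx⟩⟩
  obtain ⟨m, h₁, h₂⟩ : ∃ m, Branching T g (B ∩ Set.Iic m) ∧ Branching T g (B ∩ Set.Ici m) := by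
    have hne : {m ∈ B | Branching T g (B ∩ Set.Iic m)}.Nonempty := by
      obtain ⟨m, hm, hmax⟩ := Set.exists_max_image B id hBf hB.nonempty
      refine ⟨m, hm, ?_⟩
      have hsub : B ⊆ B ∩ Set.Iic m := fun x hx => ⟨hx, hmax x hx⟩
      rcases hB.split Set.univ with h | h
      · exact h.mono (Set.inter_subset_left.trans hsub)
      · exact h.mono (Set.sdiff_subset.trans hsub)
    obtain ⟨m, hm, hmin⟩ := Set.exists_min_image _ id (hBf.subset (Set.sep_subset _ _)) hne
    refine ⟨m, hm.2, ?_⟩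
    rcases hB.split (Set.Iio m) with h | h
    · obtain ⟨m', hm', hlt, hb⟩ := aux m h
      exact absurd (hmin m' ⟨hm', hb⟩) (not_le.2 hlt)
    · exact h.mono fun x hx => ⟨hx.1, Set.mem_Ici.2 (not_lt.1 hx.2)⟩
  have hlt : ∀ {y}, y ∉ Set.Iic m → S.le i m y := fun {y} hy =>
    (S.total i m y).resolve_right hy
  rcases hR.split (Set.Iic m) with h | h
  · exact ⟨_, Set.inter_subset_left.trans hBL, _, Set.inter_subset_left, h₂, h,
      Or.inr fun x hx y hy => S.trans i _ _ _ hy.2 hx.2⟩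
  · exact ⟨_, Set.inter_subset_left.trans hBL, _, Set.sdiff_subset, h₁, h,
      Or.inl fun x hx y hy => S.trans i _ _ _ hx.2 (hlt hy.2)⟩

lemma exists_branching_separate (S : PermStruct n Γ) (T : Γ → Set Γ) (K : Finset (Fin n)) (g : ℕ) :
    ∃ g', ∀ L R : Set Γ, Branching T g' L → Branching T g' R →
      ∃ L' ⊆ L, ∃ R' ⊆ R, Branching T g L' ∧ Branching T g R' ∧ ∀ i ∈ K,
        ((∀ x ∈ L', ∀ y ∈ R', S.le i x y) ∨ (∀ x ∈ L', ∀ y ∈ R', S.le i y x)) := by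
  classical
  induction K using Finset.induction_on generalizing g with
  | empty => exact ⟨g, fun L R hL hR => ⟨L, subset_rfl, R, subset_rfl, hL, hR, by simp⟩⟩
  | insert i K _ ih =>
    obtain ⟨g', hg'⟩ := ih (g + g)
    refine ⟨g', fun L R hL hR => ?_⟩
    obtain ⟨L₁, hL₁, R₁, hR₁, bL₁, bR₁, h₁⟩ := hg' L R hL hR
    obtain ⟨L₂, hL₂, R₂, hR₂, bL₂, bR₂, h₂⟩ := Branching.separate S i bL₁ bR₁
    refine ⟨L₂, hL₂.trans hL₁, R₂, hR₂.trans hR₁, bL₂, bR₂, fun j hj => ?_⟩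
    rcases Finset.mem_insert.1 hj with rfl | hj
    · exact h₂
    · exact (h₁ j hj).imp (fun h x hx y hy => h x (hL₂ hx) y (hR₂ hy))
        (fun h x hx y hy => h x (hL₂ hx) y (hR₂ hy))

open Classical in
lemma exists_monoBranching (S : PermStruct n Γ) (T : Γ → Set Γ) (m : ℕ) :
    ∃ N, ∀ d : (Fin n → Prop) → ℕ, ∑ a, d a = m → ∀ A, Branching T N A →
      ∃ a, MonoBranching S T a (d a) A := by
  induction m with
  | zero =>
    refine ⟨0, fun d hd A hA => ⟨fun _ => True, ?_⟩⟩
    rw [Finset.sum_eq_zero_iff] at hd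
    rw [hd _ (Finset.mem_univ _)]
    exact hA
  | succ m ih =>
    obtain ⟨N, hN⟩ := ih
    obtain ⟨g, hg⟩ := exists_branching_separate S T Finset.univ N
    refine ⟨g + 1, fun d hd A hA => ?_⟩
    obtain ⟨z₁, z₂, hz, h₁, h₂⟩ := hA
    obtain ⟨L, hL, R, hR, bL, bR, hsep⟩ := hg _ _ h₁ h₂
    let a : Fin n → Prop := fun i => ∀ x ∈ L, ∀ y ∈ R, S.le i x y
    have ha : ∀ x ∈ L, ∀ y ∈ R, S.HasType a x y := by
      intro x hx y hy
      have hne : x ≠ y := by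
        rintro rfl
        exact Set.disjoint_left.1 hz (hL hx).2 (hR hy).2
      refine ⟨hne, fun i => ⟨fun h => ?_, fun h => h x hx y hy⟩⟩
      by_contra hi
      exact hne (S.antisymm i _ _ h (((hsep i (Finset.mem_univ i)).resolve_left hi) x hx y hy))
    rcases hda : d a with _ | k
    · refine ⟨a, ?_⟩
      rw [hda]
      exact bL.nonempty.mono (hL.trans Set.inter_subset_left)
    · have hsum : ∑ b, Function.update d a k b = m := by
        have h₁ := Finset.sum_update_of_mem (Finset.mem_univ a) d k
        have h₂ := Finset.sum_eq_add_sum_sdiff_singleton_of_mem (Finset.mem_univ a) d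
        omega
      obtain ⟨b, hb⟩ := hN _ hsum L bL
      by_cases hba : b = a
      · subst hba
        obtain ⟨c, hc⟩ := hN _ hsum R bR
        by_cases hca : c = a
        · subst hca
          refine ⟨a, ?_⟩
          rw [Function.update_self] at hb hc
          rw [hda]
          exact ⟨z₁, z₂, L, R, hL, hR, hz, ha, hb, hc⟩
        · rw [Function.update_of_ne hca] at hc
          exact ⟨c, hc.mono (hR.trans Set.inter_subset_left)⟩
      · rw [Function.update_of_ne hba] at hb
        exact ⟨b, hb.mono (hL.trans Set.inter_subset_left)⟩

/-- In a homogeneous permutation structure there is no invariant laminar family, indexed by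
points, in which every member contains two disjoint members. -/
theorem Homogeneous.no_splitting_laminar_family [Nonempty Γ] (hS : S.Homogeneous)
    (hdef : S.Definable fun z x => x ∈ T z)
    (hlam : ∀ x y w, w ∈ T x → w ∈ T y → T x ⊆ T y ∨ T y ⊆ T x)
    (hself : ∀ z, z ∈ T z)
    (hsplit : ∀ z, ∃ z₁ z₂, Disjoint (T z₁) (T z₂) ∧ T z₁ ⊆ T z ∧ T z₂ ⊆ T z) : False := by
  classical
  have hbr : ∀ d z, Branching T d (T z) := by
    intro d
    induction d with
    | zero => exact fun z => ⟨z, hself z⟩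
    | succ d ih =>
      intro z
      obtain ⟨z₁, z₂, hd, h₁, h₂⟩ := hsplit z
      refine ⟨z₁, z₂, hd, ?_, ?_⟩
      · rw [Set.inter_eq_right.2 h₁]
        exact ih z₁
      · rw [Set.inter_eq_right.2 h₂]
        exact ih z₂
  obtain ⟨N, hN⟩ := exists_monoBranching S T (∑ _a : Fin n → Prop, 2)
  obtain ⟨a, z₁, z₂, A₁, A₂, h₁, h₂, hd, ha, m₁, m₂⟩ :=
    hN (fun _ => 2) rfl _ (hbr N (Classical.arbitrary Γ))
  have m₁' := m₁.nonempty
  have m₂' := m₂.nonempty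
  obtain ⟨u₁, u₂, B₁, B₂, hB₁, hB₂, -, hB, ⟨p, hp⟩, ⟨q, hq⟩⟩ :=
    (show MonoBranching S T a 1 A₁ from m₁)
  obtain ⟨v₁, v₂, C₁, C₂, hC₁, hC₂, -, hC, ⟨s, hs⟩, ⟨t, ht⟩⟩ :=
    (show MonoBranching S T a 1 A₂ from m₂)
  obtain ⟨w, hw⟩ := m₂'
  obtain ⟨r, hr⟩ := m₁'
  have hpA := (hB₁ hp).1
  have hqA := (hB₂ hq).1
  have hsA := (hC₁ hs).1
  have htA := (hC₂ ht).1
  obtain ⟨σ, hσ, hσp, hσq, hσw⟩ := hS.exists_auto_triple (hB p hp q hq) (ha p hpA w hw)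
    (ha q hqA w hw) (ha r hr s hsA) (ha r hr t htA) (hC s hs t ht)
  have hr' : r ∈ T (σ z₁) := hσp ▸ (hdef σ hσ z₁ p).1 (h₁ hpA).2
  have hs' : s ∈ T (σ z₁) := hσq ▸ (hdef σ hσ z₁ q).1 (h₁ hqA).2
  have ht' : t ∉ T (σ z₁) := fun h => by
    rw [← hσw] at h
    exact Set.disjoint_left.1 hd ((hdef σ hσ z₁ w).2 h) (h₂ hw).2
  rcases hlam _ _ s hs' (h₂ hsA).2 with h | h
  · exact Set.disjoint_left.1 hd (h₁ hr).2 (h hr')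
  · exact ht' (h (h₂ htA).2)

/-! ### Unboundedness of types outside a maximal convex relation -/

/-- Let `r` be a definable linear order and `E` a maximal proper definable `r`-convex equivalence
relation. If `a` is a two-type contained in `r` and disjoint from `E`, then for every `x` the set
of realizations of `a` over `x` is unbounded. -/
theorem Homogeneous.exists_hasType_ge (hS : S.Homogeneous) (hn : 2 ≤ n) {r E : Γ → Γ → Prop}
    (hr : S.Definable r) (htot : ∀ x y, r x y ∨ r y x) (hanti : ∀ x y, r x y → r y x → x = y)
    (htrans : ∀ x y z, r x y → r y z → r x z)
    (hE : S.Definable E) (hEeq : Equivalence E)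
    (hEconv : ∀ x y z, r x y → r y z → E x z → E x y)
    (hEmax : ∀ G : Γ → Γ → Prop, S.Definable G → Equivalence G →
      (∀ x y z, r x y → r y z → G x z → G x y) → (∀ x y, E x y → G x y) →
      (¬ ∀ x y, G x y → E x y) → ∀ x y, G x y)
    {a : Fin n → Prop} {u v : Γ} (ha : S.HasType a u v) (hruv : r u v) (hEuv : ¬ E u v)
    (x b : Γ) : ∃ y, S.HasType a x y ∧ r b y := by
  by_contra! hb
  -- `D c x` is the initial segment generated by the realizations of `c` over `x`.
  let D : (Fin n → Prop) → Γ → Set Γ := fun c x => {w | ∃ y, S.HasType c x y ∧ r w y}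
  have hDdef : ∀ c, S.Definable fun x w => w ∈ D c x := fun c => definable_of_imp <| by
    rintro σ hσ p q ⟨y, hy, hqy⟩
    exact ⟨σ y, hσ.hasType hy, (hr σ hσ _ _).1 hqy⟩
  have hDdown : ∀ {c p w w'}, w ∈ D c p → r w' w → w' ∈ D c p := by
    rintro c p w w' ⟨y, hy, hwy⟩ hw
    exact ⟨y, hy, htrans _ _ _ hw hwy⟩
  have hrefl : ∀ p, r p p := fun p => (htot p p).elim id id
  let Adm : Set (Fin n → Prop) := {c | ∃ p q, S.HasType c p q ∧ r p q ∧ ¬ E p q}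
  obtain ⟨c, ⟨p₀, q₀, hc, hrc, hEc⟩, hcmin⟩ : ∃ c ∈ Adm, ∀ c' ∈ Adm, D c x ⊆ D c' x := by
    obtain ⟨c, hc, hcm⟩ := (Set.toFinite Adm).exists_minimalFor (fun c => D c x) Adm
      ⟨a, u, v, ha, hruv, hEuv⟩
    refine ⟨c, hc, fun c' hc' => ?_⟩
    by_contra hnot
    obtain ⟨w, hw, hw'⟩ := Set.not_subset.1 hnot
    refine hnot (hcm hc' fun w' h => ?_)
    refine hDdown hw ((htot w' w).resolve_right fun h' => hw' (hDdown h h'))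
  replace hcmin : ∀ c' ∈ Adm, ∀ p, D c p ⊆ D c' p := by
    intro c' hc' p w hw
    obtain ⟨σ, hσ, rfl⟩ := hS.exists_auto p x
    exact (hDdef c' σ hσ _ _).2 (hcmin c' hc' ((hDdef c σ hσ _ _).1 hw))
  have hcr : ∀ {p q}, S.HasType c p q → r p q := fun h => hr.of_hasType hS hc h hrc
  have hcE : ∀ {p q}, S.HasType c p q → ¬ E p q := fun h h' =>
    hEc (hE.of_hasType hS h hc h')
  have hcD : ∀ {p q}, S.HasType c p q → q ∈ D c p := fun {p q} h => ⟨q, h, hrefl q⟩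
  have hex : ∀ p, ∃ q, S.HasType c p q := hS.exists_hasType hc
  have hbD : b ∉ D c x := fun h => by
    obtain ⟨y, hy, hby⟩ := hcmin a ⟨u, v, ha, hruv, hEuv⟩ x h
    exact hb y hy hby
  have hDself : ∀ p, p ∈ D c p := fun p => by
    obtain ⟨q, hq⟩ := hex p
    exact ⟨q, hq, hcr hq⟩
  have hDnest : ∀ {p q}, q ∈ D c p → r p q → ¬ E p q → D c q ⊆ D c p := by
    intro p q hq hpq hEpq w hw
    have hne : p ≠ q := fun h => hEpq (h ▸ hEeq.refl p)
    obtain ⟨y, hy, hwy⟩ := hcmin _ ⟨p, q, hasType_self hne, hpq, hEpq⟩ q hw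
    have hpy := (hasType_self hne).trans hn hy
    exact hDdown ((hDdef c).of_hasType hS (hasType_self hne) hpy hq) hwy
  have hDsat : ∀ {p w w'}, w ∈ D c p → E w w' → w' ∈ D c p := by
    rintro p w w' ⟨y, hy, hwy⟩ hww'
    obtain ⟨z, hz⟩ := hex y
    refine ⟨z, hy.trans hn hz, (htot w' z).resolve_right fun hzw' => ?_⟩
    have h₁ := hEconv w y w' hwy (htrans _ _ _ (hcr hz) hzw') hww'
    have h₂ := hEconv w z w' (htrans _ _ _ hwy (hcr hz)) hzw' hww'
    exact hcE hz (hEeq.trans (hEeq.symm h₁) h₂)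
  -- The laminar family.
  let T : Γ → Set Γ := fun z => {w | (∃ z', E z z' ∧ w ∈ D c z') ∧ (r z w ∨ E z w)}
  have hTdef : S.Definable fun z w => w ∈ T z := definable_of_imp <| by
    rintro σ hσ z w ⟨⟨z', hz', hw⟩, h⟩
    exact ⟨⟨σ z', (hE σ hσ _ _).1 hz', (hDdef c σ hσ _ _).1 hw⟩,
      h.imp (hr σ hσ _ _).1 (hE σ hσ _ _).1⟩
  have hTE : ∀ {z w}, E z w → w ∈ T z := fun {z w} h =>
    ⟨⟨z, hEeq.refl z, hDsat (hDself z) h⟩, Or.inr h⟩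
  have hTself : ∀ z, z ∈ T z := fun z => hTE (hEeq.refl z)
  have hTconv : ∀ {z w w' t}, w ∈ T z → w' ∈ T z → r w t → r t w' → t ∈ T z := by
    rintro z w w' t ⟨-, hw⟩ ⟨⟨z', hz', hw'⟩, -⟩ hwt htw'
    refine ⟨⟨z', hz', hDdown hw' htw'⟩, ?_⟩
    rcases hw with hw | hw
    · exact Or.inl (htrans _ _ _ hw hwt)
    · rcases htot z t with h | h
      · exact Or.inl h
      · exact Or.inr (hEeq.trans hw (hEconv _ _ _ hwt h (hEeq.symm hw)))
  have hlow : ∀ {p q w}, r p q → (r q w ∨ E q w) → (r p w ∨ E p w) := by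
    rintro p q w hpq (h | h)
    · exact Or.inl (htrans _ _ _ hpq h)
    · rcases htot p w with h' | h'
      · exact Or.inl h'
      · have := hEconv _ _ _ h' hpq (hEeq.symm h)
        exact Or.inr (hEeq.symm this)
  have hTnest : ∀ {p q w}, w ∈ T p → w ∈ T q → r p q → T q ⊆ T p := by
    rintro p q w ⟨⟨p', hp', hw⟩, -⟩ ⟨-, hw'⟩ hpq t ⟨⟨q', hq', ht⟩, ht'⟩
    refine ⟨?_, hlow hpq ht'⟩
    by_cases hEpq : E p q
    · exact ⟨q', hEeq.trans hEpq hq', ht⟩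
    · have hqD : q ∈ D c p' := hw'.elim (hDdown hw) fun h => hDsat hw (hEeq.symm h)
      have hE' : ¬ E p' q' := fun h =>
        hEpq (hEeq.trans (hEeq.trans hp' h) (hEeq.symm hq'))
      have hp'q : r p' q := (htot p' q).resolve_right fun h => hEpq (hEconv _ _ _ hpq h hp')
      have hp'q' : r p' q' := (htot p' q').resolve_right fun h =>
        hE' (hEeq.symm (hEconv _ _ _ h hp'q (hEeq.symm hq')))
      exact ⟨p', hp', hDnest (hDsat hqD hq') hp'q' hE' ht⟩
  have hTlam : ∀ p q w, w ∈ T p → w ∈ T q → T p ⊆ T q ∨ T q ⊆ T p := fun p q w hp hq =>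
    (htot p q).symm.imp (hTnest hq hp) (hTnest hp hq)
  have hTout : ∃ z w, r z w ∧ w ∉ T z := by
    obtain ⟨y, hy⟩ := hex x
    refine ⟨y, b, (htot y b).resolve_right fun h => hbD (hDdown (hcD hy) h), ?_⟩
    rintro ⟨⟨y', hy', hby'⟩, -⟩
    have hE' : ¬ E x y' := fun h => hcE hy (hEeq.trans h (hEeq.symm hy'))
    have hxy' : r x y' := (htot x y').resolve_right fun h =>
      hE' (hEeq.symm (hEconv _ _ _ h (hcr hy) (hEeq.symm hy')))
    exact hbD (hDnest (hDsat (hcD hy) hy') hxy' hE' hby')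
  have huniv : ∀ p q, ∃ z, p ∈ T z ∧ q ∈ T z := by
    refine hEmax (fun p q => ∃ z, p ∈ T z ∧ q ∈ T z) (definable_of_imp ?_)
      ⟨fun p => ⟨p, hTself p, hTself p⟩, ?_, ?_⟩ ?_ ?_ ?_
    · rintro σ hσ p q ⟨z, hp, hq⟩
      exact ⟨σ z, (hTdef σ hσ _ _).1 hp, (hTdef σ hσ _ _).1 hq⟩
    · rintro p q ⟨z, hp, hq⟩
      exact ⟨z, hq, hp⟩
    · rintro p q w ⟨z, hp, hq⟩ ⟨z', hq', hw⟩
      rcases hTlam _ _ _ hq hq' with h | h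
      · exact ⟨z', h hp, hw⟩
      · exact ⟨z, hp, h hw⟩
    · rintro p q w hpq hqw ⟨z, hp, hw⟩
      exact ⟨z, hp, hTconv hp hw hpq hqw⟩
    · exact fun p q h => ⟨p, hTself p, hTE h⟩
    · intro h
      obtain ⟨y, hy⟩ := hex x
      exact hcE hy (h x y ⟨x, hTself x, ⟨x, hEeq.refl x, hcD hy⟩, Or.inl (hcr hy)⟩)
  have : Nonempty Γ := ⟨x⟩
  refine hS.no_splitting_laminar_family hTdef hTlam hTself fun z' => ?_
  obtain ⟨z₁, z₂, hz, hz₂⟩ := hTout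
  have hz₁ : z₁ ∉ T z₂ := by
    rintro ⟨-, h | h⟩
    · exact hz₂ (hanti _ _ hz h ▸ hTself z₁)
    · exact hz₂ (hTE (hEeq.symm h))
  obtain ⟨z, h₁, h₂⟩ := huniv z₁ z₂
  have s₁ : T z₁ ⊆ T z := (hTlam _ _ _ (hTself z₁) h₁).resolve_right fun h => hz₂ (h h₂)
  have s₂ : T z₂ ⊆ T z := (hTlam _ _ _ (hTself z₂) h₂).resolve_right fun h => hz₁ (h h₁)
  have hdis : Disjoint (T z₁) (T z₂) := Set.disjoint_left.2 fun w hw hw' =>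
    (hTlam _ _ _ hw hw').elim (fun h => hz₁ (h (hTself z₁))) fun h => hz₂ (h (hTself z₂))
  obtain ⟨σ, hσ, rfl⟩ := hS.exists_auto z z'
  have himg : ∀ p w, w ∈ T (σ p) ↔ σ.symm w ∈ T p := fun p w => by
    simpa using (hTdef σ hσ p (σ.symm w)).symm
  refine ⟨σ z₁, σ z₂, Set.disjoint_left.2 fun w hw hw' => ?_, fun w hw => ?_, fun w hw => ?_⟩
  · exact Set.disjoint_left.1 hdis ((himg _ _).1 hw) ((himg _ _).1 hw')
  · exact (himg _ _).2 (s₁ ((himg _ _).1 hw))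
  · exact (himg _ _).2 (s₂ ((himg _ _).1 hw))

/-- For each order there is a maximal proper definable convex equivalence relation. -/
lemma Homogeneous.exists_maximal_convex [Nontrivial Γ] (hS : S.Homogeneous) (i : Fin n) :
    ∃ E : Γ → Γ → Prop, S.Definable E ∧ Equivalence E ∧ S.Convex i E ∧ (¬ ∀ x y, E x y) ∧
      ∀ G : Γ → Γ → Prop, S.Definable G → Equivalence G → S.Convex i G →
        (∀ x y, E x y → G x y) → (¬ ∀ x y, G x y → E x y) → ∀ x y, G x y := by
  let P : Set (Γ → Γ → Prop) :=
    {E | S.Definable E ∧ Equivalence E ∧ S.Convex i E ∧ ¬ ∀ x y, E x y}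
  have hfin : P.Finite := hS.finite_definable.subset fun E hE => hE.1
  have hne : P.Nonempty := by
    refine ⟨Eq, fun σ _ x y => (σ.injective.eq_iff).symm, eq_equivalence, ?_, ?_⟩
    · rintro x y z hxy hyz rfl
      exact S.antisymm i _ _ hxy hyz
    · obtain ⟨x, y, hxy⟩ := exists_pair_ne Γ
      exact fun h => hxy (h x y)
  obtain ⟨E, hE, hmax⟩ := hfin.exists_maximal hne
  refine ⟨E, hE.1, hE.2.1, hE.2.2.1, hE.2.2.2, fun G hG hGe hGc hEG hGE => ?_⟩
  by_contra hGu
  exact hGE (hmax (y := G) ⟨hG, hGe, hGc, hGu⟩ hEG)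

/-- Every realization of a type outside a maximal proper definable `≤ⱼ`-convex equivalence
relation can be moved past any given point in the `j`-th order. -/
lemma Homogeneous.exists_hasType_beyond (hS : S.Homogeneous) (hn : 2 ≤ n) {j : Fin n}
    {E : Γ → Γ → Prop} (hE : S.Definable E) (hEeq : Equivalence E) (hEconv : S.Convex j E)
    (hEmax : ∀ G : Γ → Γ → Prop, S.Definable G → Equivalence G → S.Convex j G →
      (∀ x y, E x y → G x y) → (¬ ∀ x y, G x y → E x y) → ∀ x y, G x y)
    {a : Fin n → Prop} {u v : Γ} (ha : S.HasType a u v) (hEuv : ¬ E u v) (x b : Γ) :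
    ∃ y, S.HasType a x y ∧ (a j → S.le j b y) ∧ (¬ a j → S.le j y b) := by
  by_cases haj : a j
  · obtain ⟨y, hy, h⟩ := hS.exists_hasType_ge hn (definable_le j) (S.total j) (S.antisymm j)
      (S.trans j) hE hEeq hEconv hEmax ha ((ha.2 j).2 haj) hEuv x b
    exact ⟨y, hy, fun _ => h, fun h' => absurd haj h'⟩
  · have hflip : ∀ {G : Γ → Γ → Prop}, Equivalence G →
        ((∀ x y z, S.le j y x → S.le j z y → G x z → G x y) ↔ S.Convex j G) := by
      refine fun {G} hG => ⟨fun h x y z hxy hyz hxz => ?_, fun h x y z hxy hyz hxz => ?_⟩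
      · exact hG.trans hxz (h z y x hyz hxy (hG.symm hxz))
      · exact hG.trans hxz (h z y x hyz hxy (hG.symm hxz))
    obtain ⟨y, hy, h⟩ := hS.exists_hasType_ge hn (r := fun x y => S.le j y x)
      (fun σ hσ x y => hσ j y x) (fun x y => S.total j y x)
      (fun x y h h' => S.antisymm j x y h' h) (fun x y z h h' => S.trans j _ _ _ h' h) hE hEeq
      ((hflip hEeq).2 hEconv)
      (fun G hG hGe hGc => hEmax G hG hGe ((hflip hGe).1 hGc)) ha ((ha.le_symm_iff j).2 haj)
      hEuv x b
    exact ⟨y, hy, fun h' => absurd h' haj, fun _ => h⟩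

/-- If an equivalence relation `F` is contained in none of finitely many definable equivalence
relations, then it is not contained in their union. -/
lemma Homogeneous.exists_forall_not (hS : S.Homogeneous) (hn : 2 ≤ n) [Nonempty Γ]
    {F : Γ → Γ → Prop} (hF : S.Definable F) (hFeq : Equivalence F)
    {ι : Type*} (K : Finset ι) {E : ι → Γ → Γ → Prop} (hE : ∀ j ∈ K, S.Definable (E j))
    (hEeq : ∀ j ∈ K, Equivalence (E j)) (hEF : ∀ j ∈ K, ¬ ∀ x y, F x y → E j x y) :
    ∃ x y, F x y ∧ ∀ j ∈ K, ¬ E j x y := by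
  classical
  induction K using Finset.induction_on with
  | empty => exact ⟨Classical.arbitrary Γ, Classical.arbitrary Γ, hFeq.refl _, by simp⟩
  | insert k K _ ih =>
    obtain ⟨x, y, hxy, hK⟩ := ih (fun j hj => hE j (Finset.mem_insert_of_mem hj))
      (fun j hj => hEeq j (Finset.mem_insert_of_mem hj))
      (fun j hj => hEF j (Finset.mem_insert_of_mem hj))
    have hk := Finset.mem_insert_self k K
    by_cases hkxy : E k x y
    swap
    · exact ⟨x, y, hxy, Finset.forall_mem_insert _ _ _ |>.2 ⟨hkxy, hK⟩⟩
    obtain ⟨u, v, huv, hkuv⟩ : ∃ u v, F u v ∧ ¬ E k u v := by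
      simpa using hEF k hk
    have hne : u ≠ v := fun h => hkuv (h ▸ (hEeq k hk).refl u)
    have ht := hasType_self (S := S) hne
    set t : Fin n → Prop := fun i => S.le i u v
    choose g hg using hS.exists_hasType ht
    let s : ℕ → Γ := fun m => g^[m] y
    have hs : ∀ {m l}, m < l → S.HasType t (s m) (s l) := by
      have : IsTrans Γ (S.HasType t) := ⟨fun _ _ _ h h' => h.trans hn h'⟩
      refine fun {m l} h => Nat.rel_of_forall_rel_succ_of_lt (S.HasType t) (fun m => ?_) h
      simp only [s, Function.iterate_succ_apply']
      exact hg _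
    have hsF : ∀ m, F x (s m) := by
      intro m
      rcases Nat.eq_zero_or_pos m with rfl | hm
      · exact hxy
      · exact hFeq.trans hxy (hF.of_hasType hS ht (hs hm) huv)
    have hbad : ∀ j ∈ K, {m | E j x (s m)}.Finite := by
      intro j hj
      have hj' := Finset.mem_insert_of_mem (b := k) hj
      have he := hEeq j hj'
      by_cases hjt : E j u v
      · refine (Set.finite_empty).subset fun m hm => hK j hj ?_
        rcases Nat.eq_zero_or_pos m with rfl | hm0
        · exact hm
        · exact he.trans hm (he.symm ((hE j hj').of_hasType hS ht (hs hm0) hjt))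
      · refine Set.Subsingleton.finite fun m hm l hl => ?_
        have key : ∀ {m l}, E j x (s m) → E j x (s l) → ¬ m < l := fun hm hl hlt =>
          hjt ((hE j hj').of_hasType hS (hs hlt) ht (he.trans (he.symm hm) hl))
        exact le_antisymm (not_lt.1 (key hl hm)) (not_lt.1 (key hm hl))
    obtain ⟨m, hm⟩ := ((Set.finite_singleton 0).union
      (K.finite_toSet.biUnion hbad)).infinite_compl.nonempty
    simp only [Set.mem_compl_iff, Set.mem_union, Set.mem_singleton_iff, Set.mem_iUnion,
      Set.mem_ofPred_eq, not_or, not_exists] at hm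
    refine ⟨x, s m, hsF m, Finset.forall_mem_insert _ _ _ |>.2 ⟨fun h => ?_, fun j hj h =>
      hm.2 j hj h⟩⟩
    have hym : E k y (s m) := (hEeq k hk).trans ((hEeq k hk).symm hkxy) h
    exact hkuv ((hE k hk).of_hasType hS (hs (Nat.pos_of_ne_zero hm.1)) ht hym)

end PermStruct

/-- In a homogeneous `n`-dimensional permutation structure with `n ≥ 2`, any maximal
∅-definable equivalence relation is convex with respect to at least two of the orders. -/
theorem maximal_relation_convex_for_two_orders
    {n : ℕ} {Γ : Type*} [Countable Γ] [Infinite Γ] (S : PermStruct n Γ)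
    (hn : 2 ≤ n) (hhom : S.Homogeneous)
    (F : Γ → Γ → Prop) (hFdef : S.Definable F) (hFequiv : Equivalence F)
    (hFproper : ¬ ∀ x y, F x y)
    (hFmax : ∀ G : Γ → Γ → Prop, S.Definable G → Equivalence G →
      (∀ x y, F x y → G x y) → (¬ ∀ x y, G x y → F x y) → ∀ x y, G x y) :
    ∃ i j, i ≠ j ∧ S.Convex i F ∧ S.Convex j F := by
  classical
  choose E hE hEeq hEconv hEproper hEmax using fun i : Fin n => hhom.exists_maximal_convex i
  by_contra! hcon
  let J : Finset (Fin n) := Finset.univ.filter fun j => ¬ S.Convex j F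
  have hJ : ∀ {j}, j ∈ J ↔ ¬ S.Convex j F := by simp [J]
  have hEF : ∀ j ∈ J, ¬ ∀ x y, F x y → E j x y := by
    intro j hj h
    by_cases h' : ∀ x y, E j x y → F x y
    · refine hJ.1 hj fun x y z hxy hyz hxz => h' _ _ (hEconv j x y z hxy hyz (h _ _ hxz))
    · exact hEproper j (hFmax _ (hE j) (hEeq j) h h')
  obtain ⟨x, z, hxz, hnE⟩ := hhom.exists_forall_not hn hFdef hFequiv J
    (fun j _ => hE j) (fun j _ => hEeq j) hEF
  obtain ⟨k, hk⟩ : ∃ k : Fin n, ∀ j, j ≠ k → j ∈ J := by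
    by_cases h : ∃ k, S.Convex k F
    · obtain ⟨k, hk⟩ := h
      exact ⟨k, fun j hj => hJ.2 (hcon k j hj.symm hk)⟩
    · exact ⟨⟨0, by omega⟩, fun j _ => hJ.2 fun hj => h ⟨j, hj⟩⟩
  have hne : x ≠ z := by
    obtain ⟨j, hj⟩ : ∃ j, j ≠ k := by
      have : Nontrivial (Fin n) := Fin.nontrivial_iff_two_le.2 hn
      exact exists_ne k
    exact fun h => hnE j (hk j hj) (h ▸ (hEeq j).refl x)
  have hs := PermStruct.hasType_self (S := S) hne
  set s : Fin n → Prop := fun i => S.le i x z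
  obtain ⟨p, q, hpq, hle⟩ : ∃ p q, ¬ F p q ∧ S.le k p q := by
    simp only [not_forall] at hFproper
    obtain ⟨p, q, h⟩ := hFproper
    rcases S.total k p q with h' | h'
    · exact ⟨p, q, h, h'⟩
    · exact ⟨q, p, fun h'' => h (hFequiv.symm h''), h'⟩
  obtain ⟨b, hxb, hb₁, hb₂⟩ : ∃ b, ¬ F x b ∧ (s k → S.le k b x) ∧ (¬ s k → S.le k x b) := by
    by_cases hsk : s k
    · obtain ⟨σ, hσ, rfl⟩ := hhom.exists_auto q x
      exact ⟨σ p, fun h => hpq (hFequiv.symm ((hFdef σ hσ _ _).2 h)),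
        fun _ => (hσ k _ _).1 hle, fun h => absurd hsk h⟩
    · obtain ⟨σ, hσ, rfl⟩ := hhom.exists_auto p x
      exact ⟨σ q, fun h => hpq ((hFdef σ hσ _ _).2 h), fun h => absurd h hsk,
        fun _ => (hσ k _ _).1 hle⟩
  obtain ⟨y, hy, hbeyond⟩ : ∃ y, S.HasType s x y ∧
      ∀ j ∈ J, (s j → S.le j b y) ∧ (¬ s j → S.le j y b) := by
    suffices ∀ K ⊆ J, ∃ y, S.HasType s x y ∧
        ∀ j ∈ K, (s j → S.le j b y) ∧ (¬ s j → S.le j y b) from this J subset_rfl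
    intro K
    induction K using Finset.induction_on with
    | empty => exact fun _ => ⟨z, hs, by simp⟩
    | insert i K _ ih =>
      intro hK
      obtain ⟨y, hy, h⟩ := ih ((Finset.subset_insert i K).trans hK)
      obtain ⟨w, hw, h'⟩ := hhom.exists_hasType_beyond hn (hE i) (hEeq i) (hEconv i) (hEmax i)
        hs (hnE i (hK (Finset.mem_insert_self i K))) y b
      refine ⟨w, hy.trans hn hw, Finset.forall_mem_insert _ _ _ |>.2 ⟨h', fun j hj => ?_⟩⟩
      exact ⟨fun hsj => S.trans j _ _ _ ((h j hj).1 hsj) ((hw.2 j).2 hsj),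
        fun hsj => S.trans j _ _ _ ((hw.le_symm_iff j).2 hsj) ((h j hj).2 hsj)⟩
  have hxy : F x y := hFdef.of_hasType hhom hs hy hxz
  have hby : b ≠ y := fun h => hxb (h ▸ hxy)
  have hside : ∀ j, (s j → S.le j b y) ∧ (¬ s j → S.le j y b) := by
    intro j
    by_cases hj : j = k
    · subst hj
      exact ⟨fun h => S.trans j _ _ _ (hb₁ h) ((hy.2 j).2 h),
        fun h => S.trans j _ _ _ ((hy.le_symm_iff j).2 h) (hb₂ h)⟩
    · exact hbeyond j (hk j hj)
  have htype : S.HasType s b y := ⟨hby, fun j => ⟨fun h => by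
    by_contra hsj
    exact hby (S.antisymm j _ _ h ((hside j).2 hsj)), (hside j).1⟩⟩
  exact hxb (hFequiv.trans hxy (hFequiv.symm (hFdef.of_hasType hhom hs htype hxz)))
end
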